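/- Let G be a finite group, N a normal subgroup of G, χ an irreducible complex character of G, and ψ an irreducible complex character of N that is a constituent of the restriction of χ to N. Let p be an odd prime, let I_G(ψ) = {g ∈ G : ψ(g⁻¹xg) = ψ(x) for all x ∈ N} be the inertia group of ψ in G, and let e = ⟨χ↓_N, ψ⟩ be the multiplicity of ψ in χ↓_N (the ramification index). Assume that p ∤ [G : I_G(ψ)], p ∤ e, p ∤ χ(1), and that there exists a p-element g of G lying in N such that, writing f_χ = p^a·m with p ∤ m for the conductor of χ, p does not divide [Q(ζ_{p^a}) : Q(χ(g))]. Then p ∤ ψ(1) and Property 1.3 holds for (N, ψ, p), i.e., writing f_ψ = p^b·m' with p ∤ m', there exists a p-element h ∈ N such that p does not divide [Q(ζ_{p^b}) : Q(ψ(h))]. -/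

import Mathlib

open CategoryTheory

/-- `Qcyc N` is the `N`-th cyclotomic field `ℚ(ζ_N)`, realised as the subfield of `ℂ`
generated by all `N`-th roots of unity. -/
noncomputable def Qcyc (N : ℕ) : IntermediateField ℚ ℂ :=
  IntermediateField.adjoin ℚ {z : ℂ | z ^ N = 1}

/-- `Qadj c` is the subfield `ℚ(c)` of `ℂ` generated by a complex number `c`. -/
noncomputable def Qadj (c : ℂ) : IntermediateField ℚ ℂ :=
  IntermediateField.adjoin ℚ {c}

/-- `f` is the conductor of the complex number `c`: the least positive integer `N`
with `c ∈ ℚ(ζ_N)`. -/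
def IsConductorOf (c : ℂ) (f : ℕ) : Prop :=
  IsLeast {N : ℕ | 0 < N ∧ c ∈ Qcyc N} f

/-- `f` is the conductor of the character `χ`: the least positive integer `N` such that all
values of `χ` lie in `ℚ(ζ_N)`. -/
def IsCharConductor {G : Type*} [Monoid G] (χ : G → ℂ) (f : ℕ) : Prop :=
  IsLeast {N : ℕ | 0 < N ∧ ∀ g, χ g ∈ Qcyc N} f

/-- Property 1.3 of Navarro–Tiep for `(G, χ, p)`: writing the conductor of `χ` as
`f = p ^ a * m` with `p ∤ m` (so that `p ^ a = p ^ (f.factorization p)` is the `p`-part of `f`),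
there is a `p`-element `g ∈ G` such that `p ∤ [ℚ(ζ_{p^a}) : ℚ(χ(g))]`. -/
def Property13 {G : Type*} [Group G] (χ : G → ℂ) (p : ℕ) : Prop :=
  ∀ f : ℕ, IsCharConductor χ f →
    ∃ g : G, (∃ j : ℕ, orderOf g = p ^ j) ∧
      ¬ p ∣ (Qadj (χ g)).relfinrank (Qcyc (p ^ f.factorization p))

/-- The inertia group `I_G(ψ)` of a class function `ψ` on a normal subgroup `N` of `G`:
the set of `g ∈ G` with `ψ(g⁻¹ x g) = ψ(x)` for all `x ∈ N`. -/
def inertiaGroup {G : Type*} [Group G] {N : Subgroup G} (hN : N.Normal) (ψ : N → ℂ) :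
    Subgroup G where
  carrier := {g | ∀ (x : G) (hx : x ∈ N), ψ ⟨g⁻¹ * x * g, hN.conj_mem' x hx g⟩ = ψ ⟨x, hx⟩}
  one_mem' := by
    intro x hx
    exact congrArg ψ (Subtype.ext (by group))
  mul_mem' := by
    intro a b ha hb x hx
    have h1 := hb (a⁻¹ * x * a) (hN.conj_mem' x hx a)
    have h2 := ha x hx
    calc ψ ⟨(a * b)⁻¹ * x * (a * b), _⟩
        = ψ ⟨b⁻¹ * (a⁻¹ * x * a) * b, hN.conj_mem' _ (hN.conj_mem' x hx a) b⟩ :=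
          congrArg ψ (Subtype.ext (by group))
      _ = ψ ⟨a⁻¹ * x * a, hN.conj_mem' x hx a⟩ := h1
      _ = ψ ⟨x, hx⟩ := h2
  inv_mem' := by
    intro a ha x hx
    have h1 := ha (a * x * a⁻¹) (hN.conj_mem x hx a)
    calc ψ ⟨a⁻¹⁻¹ * x * a⁻¹, _⟩
        = ψ ⟨a * x * a⁻¹, hN.conj_mem x hx a⟩ := congrArg ψ (Subtype.ext (by group))
      _ = ψ ⟨a⁻¹ * (a * x * a⁻¹) * a, hN.conj_mem' _ (hN.conj_mem x hx a) a⟩ :=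
          h1.symm
      _ = ψ ⟨x, hx⟩ := congrArg ψ (Subtype.ext (by group))


theorem Qcyc_isCyc (N : ℕ) [NeZero N] : IsCyclotomicExtension {N} ℚ (Qcyc N) := by
  have h : IsCyclotomicExtension {N} ℚ
      (IntermediateField.adjoin ℚ {b : ℂ | ∃ n ∈ ({N} : Set ℕ), n ≠ 0 ∧ b ^ n = 1}) := by
    refine IntermediateField.isCyclotomicExtension_adjoin_of_exists_isPrimitiveRoot _ _ _ ?_
    intro n hn hn0
    exact ⟨_, Complex.isPrimitiveRoot_exp n hn0⟩
  have e : (IntermediateField.adjoin ℚ {b : ℂ | ∃ n ∈ ({N} : Set ℕ), n ≠ 0 ∧ b ^ n = 1})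
      = Qcyc N := by
    unfold Qcyc
    congr 1
    ext z
    simp [NeZero.ne N]
  rwa [e] at h

theorem Qcyc_finrank (N : ℕ) [NeZero N] : Module.finrank ℚ (Qcyc N) = N.totient := by
  have := Qcyc_isCyc N
  exact IsCyclotomicExtension.finrank (Qcyc N)
    (Polynomial.cyclotomic.irreducible_rat (Nat.pos_of_ne_zero (NeZero.ne N)))

theorem Qcyc_mono {a b : ℕ} (h : a ∣ b) : Qcyc a ≤ Qcyc b := by
  unfold Qcyc
  apply IntermediateField.adjoin.mono
  rintro z (hz : z ^ a = 1)
  obtain ⟨c, rfl⟩ := h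
  change z ^ (a * c) = 1
  rw [pow_mul, hz, one_pow]

theorem mem_Qcyc {N : ℕ} {z : ℂ} (h : z ^ N = 1) : z ∈ Qcyc N :=
  IntermediateField.subset_adjoin _ _ h

theorem Qcyc_relfinrank {p M : ℕ} (hp : p.Prime) (hM : p ∣ M) (hM0 : M ≠ 0) :
    (Qcyc M).relfinrank (Qcyc (M * p)) = p := by
  have : NeZero M := ⟨hM0⟩
  have : NeZero (M * p) := ⟨mul_ne_zero hM0 hp.ne_zero⟩
  have h := IntermediateField.finrank_bot_mul_relfinrank (Qcyc_mono (Dvd.intro p rfl : M ∣ M * p))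
  rw [Qcyc_finrank, Qcyc_finrank, mul_comm M p, Nat.totient_mul_of_prime_of_dvd hp hM,
    mul_comm p M] at h
  rw [mul_comm p M.totient] at h
  exact Nat.eq_of_mul_eq_mul_left (Nat.totient_pos.2 (Nat.pos_of_ne_zero hM0)) h

theorem Qcyc_le_adj {p M : ℕ} (hp : p.Prime) (hM : p ∣ M) (hM0 : M ≠ 0) {x : ℂ}
    (hx : x ∈ Qcyc (M * p)) (hx' : x ∉ Qcyc M) : Qcyc (M * p) ≤ Qcyc M ⊔ Qadj x := by
  have hle : Qcyc M ≤ Qcyc (M * p) := Qcyc_mono (Dvd.intro p rfl)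
  have hadj : Qadj x ≤ Qcyc (M * p) := by
    unfold Qadj; rw [IntermediateField.adjoin_simple_le_iff]; exact hx
  have h := IntermediateField.relfinrank_mul_relfinrank
    (le_sup_left : Qcyc M ≤ Qcyc M ⊔ Qadj x) (sup_le hle hadj)
  rw [Qcyc_relfinrank hp hM hM0] at h
  rcases (Nat.dvd_prime hp).1 (Dvd.intro _ h) with h1 | h1
  · rw [IntermediateField.relfinrank_eq_one_iff] at h1
    exact absurd (h1 ((le_sup_right : Qadj x ≤ _) (IntermediateField.mem_adjoin_simple_self ℚ x))) hx'
  · rw [h1] at h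
    have : IntermediateField.relfinrank (Qcyc M ⊔ Qadj x) (Qcyc (M * p)) = 1 :=
      Nat.eq_of_mul_eq_mul_left hp.pos (by rw [h, mul_one])
    rwa [IntermediateField.relfinrank_eq_one_iff] at this

theorem Qcyc_sup {a b : ℕ} (h : a.Coprime b) : Qcyc (a * b) ≤ Qcyc a ⊔ Qcyc b := by
  unfold Qcyc
  rw [IntermediateField.adjoin_le_iff]
  rintro z (hz : z ^ (a * b) = 1)
  by_cases hz0 : z = 0
  · subst hz0; exact zero_mem _
  have h1 : z ^ b ∈ Qcyc a := mem_Qcyc (by rw [← pow_mul, mul_comm, hz])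
  have h2 : z ^ a ∈ Qcyc b := mem_Qcyc (by rw [← pow_mul, hz])
  have hb := Nat.gcd_eq_gcd_ab a b
  rw [h.gcd_eq_one] at hb
  have : z = (z ^ a) ^ (Nat.gcdA a b) * (z ^ b) ^ (Nat.gcdB a b) := by
    rw [← zpow_natCast, ← zpow_natCast, ← zpow_mul, ← zpow_mul, ← zpow_add₀ hz0, ← hb]
    simp
  rw [SetLike.mem_coe, this]
  exact mul_mem (zpow_mem ((le_sup_right : Qcyc b ≤ Qcyc a ⊔ Qcyc b) h2) _)
    (zpow_mem ((le_sup_left : Qcyc a ≤ Qcyc a ⊔ Qcyc b) h1) _)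

/-- descent of the `p`-part of the conductor -/
theorem Qcyc_descent {p v d u : ℕ} (hp : p.Prime) (hv : v ≠ 0) (hu : u ≠ 0) (hpu : ¬ p ∣ u)
    (hdu : d ∣ u) {x : ℂ} (h1 : x ∈ Qcyc (p ^ (v + 1) * d)) (h2 : x ∈ Qcyc (p ^ v * u)) :
    x ∈ Qcyc (p ^ v * d) := by
  by_contra hx
  have hd : d ≠ 0 := by rintro rfl; exact hu (zero_dvd_iff.1 hdu)
  have e1 : p ^ (v + 1) * d = (p ^ v * d) * p := by ring
  rw [e1] at h1
  have hpv : p ∣ p ^ v := dvd_pow_self p hv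
  have h := Qcyc_le_adj hp (Dvd.dvd.mul_right hpv d)
    (mul_ne_zero (pow_ne_zero _ hp.ne_zero) hd) h1 hx
  have hle : Qcyc (p ^ v * d * p) ≤ Qcyc (p ^ v * u) := by
    refine h.trans (sup_le (Qcyc_mono (mul_dvd_mul_left _ hdu)) ?_)
    unfold Qadj; rw [IntermediateField.adjoin_simple_le_iff]; exact h2
  have hbig : Qcyc (p ^ v * u * p) ≤ Qcyc (p ^ v * u) := by
    have e2 : p ^ v * u * p = p ^ (v + 1) * u := by ring
    rw [e2]
    refine (Qcyc_sup (Nat.Coprime.pow_left _ ((Nat.Prime.coprime_iff_not_dvd hp).2 hpu))).trans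
      (sup_le ?_ (Qcyc_mono (Dvd.intro_left _ rfl)))
    refine (Qcyc_mono ?_).trans hle
    exact ⟨d, by ring⟩
  have := Qcyc_relfinrank hp (Dvd.dvd.mul_right hpv u)
    (mul_ne_zero (pow_ne_zero _ hp.ne_zero) hu)
  rw [IntermediateField.relfinrank_eq_one_iff.2 hbig] at this
  exact hp.one_lt.ne this

theorem Qcyc_descent_iter {p b m : ℕ} (hp : p.Prime) (hb : b ≠ 0) (hm : m ≠ 0) (hpm : ¬ p ∣ m)
    {x : ℂ} (h2 : x ∈ Qcyc (p ^ b * m)) (k : ℕ) (h1 : x ∈ Qcyc (p ^ k)) : x ∈ Qcyc (p ^ b) := by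
  induction k with
  | zero => exact Qcyc_mono (pow_dvd_pow p (Nat.zero_le b)) h1
  | succ k ih =>
    by_cases hk : k + 1 ≤ b
    · exact Qcyc_mono (pow_dvd_pow p hk) h1
    · apply ih
      have := Qcyc_descent (v := k) (d := 1) (u := m) hp (by omega) hm hpm (one_dvd _)
        (by simpa using h1)
        (Qcyc_mono (mul_dvd_mul_right (pow_dvd_pow p (by omega)) m) h2)
      simpa using this

section GaloisGeneric

variable {K C : Type*} [Field K] [Field C] [Algebra K C]

theorem gen_mem_of_fixed (A E : IntermediateField K C) [FiniteDimensional K E] [IsGalois K E]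
    (x : E) (h : ∀ σ ∈ (A.comap E.val).fixingSubgroup, σ x = x) : (x : C) ∈ A := by
  have : x ∈ IntermediateField.fixedField (A.comap E.val).fixingSubgroup := by
    rw [IntermediateField.mem_fixedField_iff]
    exact h
  rw [IsGalois.fixedField_fixingSubgroup] at this
  exact this

theorem gen_card_fixing (A E : IntermediateField K C) [FiniteDimensional K E] [IsGalois K E] :
    Nat.card (A.comap E.val).fixingSubgroup = A.relfinrank E := by
  rw [IsGalois.card_fixingSubgroup_eq_finrank, IntermediateField.finrank_comap,
    IntermediateField.fieldRange_val]

theorem gen_pow (A E : IntermediateField K C) [FiniteDimensional K E] [IsGalois K E] {p : ℕ}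
    (hrel : A.relfinrank E = p) {σ : E ≃ₐ[K] E} (hσ : σ ∈ (A.comap E.val).fixingSubgroup) :
    σ ^ p = 1 := by
  rw [← gen_card_fixing] at hrel
  have : (⟨σ, hσ⟩ : (A.comap E.val).fixingSubgroup) ^ p = 1 := by
    rw [← hrel]; exact pow_card_eq_one'
  simpa using congrArg Subtype.val this

theorem gen_unique (A E : IntermediateField K C) [FiniteDimensional K E] [IsGalois K E] {p : ℕ}
    (hp : p.Prime) (hcyc : IsCyclic (E ≃ₐ[K] E)) (hrel : A.relfinrank E = p) {x : C}
    (hx : x ∈ E) (hdvd : p ∣ (IntermediateField.adjoin K {x}).relfinrank E) : x ∈ A := by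
  have : Fact p.Prime := ⟨hp⟩
  rw [← gen_card_fixing] at hdvd
  obtain ⟨τ, hτ⟩ := exists_prime_orderOf_dvd_card' p hdvd
  refine gen_mem_of_fixed A E ⟨x, hx⟩ fun σ hσ => ?_
  have hσp : σ ^ p = 1 := gen_pow A E hrel hσ
  have hτ' : orderOf τ.1 = p := by rw [Subgroup.orderOf_coe, hτ]
  have hmem : σ ∈ Subgroup.zpowers τ.1 := by
    classical
    have hcard := IsCyclic.card_pow_eq_one_le (α := (E ≃ₐ[K] E)) hp.pos
    have hsub : (Finset.univ.filter (fun g => g ∈ Subgroup.zpowers τ.1)) ⊆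
        (Finset.univ.filter (fun g : (E ≃ₐ[K] E) => g ^ p = 1)) := by
      intro g hg
      simp only [Finset.mem_filter, Finset.mem_univ, true_and] at hg ⊢
      obtain ⟨k, rfl⟩ := Subgroup.mem_zpowers_iff.1 hg
      rw [← zpow_natCast, ← zpow_mul, mul_comm, zpow_mul, zpow_natCast, ← hτ', pow_orderOf_eq_one,
        one_zpow]
    have hc : (Finset.univ.filter (fun g => g ∈ Subgroup.zpowers τ.1)).card = p := by
      rw [← Fintype.card_subtype, ← Nat.card_eq_fintype_card]
      exact (Nat.card_zpowers τ.1).trans hτ'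
    have heq := Finset.eq_of_subset_of_card_le hsub (by rw [hc]; exact hcard)
    have : σ ∈ (Finset.univ.filter (fun g : (E ≃ₐ[K] E) => g ^ p = 1)) := by simp [hσp]
    rw [← heq] at this
    simpa using this
  have h2 : σ ∈ ((IntermediateField.adjoin K {x}).comap E.val).fixingSubgroup :=
    (Subgroup.zpowers_le.2 τ.2) hmem
  rw [IntermediateField.mem_fixingSubgroup_iff] at h2
  exact h2 ⟨x, hx⟩ (IntermediateField.mem_adjoin_simple_self K x)

theorem gen_galois_step (A E : IntermediateField K C) [FiniteDimensional K E] [IsGalois K E]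
    {p : ℕ} (hrel : A.relfinrank E = p) (x : E)
    (h : ∀ σ : E ≃+* E, (∀ y, σ^[p] y = y) →
      (∀ y : E, (y : C) ∈ A → σ y = y) → σ x = x) : (x : C) ∈ A := by
  refine gen_mem_of_fixed A E x fun σ hσ => h σ.toRingEquiv ?_ ?_
  · intro y
    have h1 := gen_pow A E hrel hσ
    have h2 : ∀ n : ℕ, (σ ^ n) y = (⇑σ.toRingEquiv)^[n] y := by
      intro n
      induction n with
      | zero => rfl
      | succ n ih =>
        rw [Function.iterate_succ_apply', ← ih, pow_succ']
        rfl
    rw [← h2, h1]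
    rfl
  · intro y hy
    rw [IntermediateField.mem_fixingSubgroup_iff] at hσ
    exact hσ y hy

end GaloisGeneric

theorem Qcyc_finiteDim (n : ℕ) [NeZero n] : FiniteDimensional ℚ (Qcyc n) := by
  have := Qcyc_isCyc n
  exact IsCyclotomicExtension.finiteDimensional {n} ℚ (Qcyc n)

theorem Qcyc_isGalois (n : ℕ) [NeZero n] :
    @IsGalois ℚ _ (Qcyc n) _ (IntermediateField.algebra' (Qcyc n)) := by
  have h := Qcyc_isCyc n
  have h2 : @IsCyclotomicExtension {n} ℚ (Qcyc n) _ _ (IntermediateField.algebra' (Qcyc n)) := by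
    convert h
    exact Subsingleton.elim _ _
  exact @IsCyclotomicExtension.isGalois {n} ℚ (Qcyc n) _ _ (IntermediateField.algebra' (Qcyc n)) h2

theorem Qcyc_unique {p b : ℕ} (hp : p.Prime) (hodd : Odd p) (hb : b ≠ 0) {x : ℂ}
    (hx : x ∈ Qcyc (p ^ (b + 1))) (hdvd : p ∣ (Qadj x).relfinrank (Qcyc (p ^ (b + 1)))) :
    x ∈ Qcyc (p ^ b) := by
  have : NeZero (p ^ (b + 1)) := ⟨pow_ne_zero _ hp.ne_zero⟩
  have := Qcyc_isCyc (p ^ (b + 1))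
  have := Qcyc_finiteDim (p ^ (b + 1))
  have := Qcyc_isGalois (p ^ (b + 1))
  have hcyc : @IsCyclic (Qcyc (p ^ (b + 1)) ≃ₐ[ℚ] Qcyc (p ^ (b + 1))) _ := by
    have h1 : IsCyclic (ZMod (p ^ (b + 1)))ˣ :=
      ZMod.isCyclic_units_of_prime_pow p hp (by rintro rfl; exact absurd hodd (by decide)) _
    exact isCyclic_of_surjective (IsCyclotomicExtension.autEquivPow (Qcyc (p ^ (b + 1)))
      (Polynomial.cyclotomic.irreducible_rat (Nat.pos_of_ne_zero (NeZero.ne (p ^ (b + 1)))))).symm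
      (MulEquiv.surjective _)
  have hrel : (Qcyc (p ^ b)).relfinrank (Qcyc (p ^ (b + 1))) = p := by
    rw [pow_succ]
    exact Qcyc_relfinrank hp (dvd_pow_self p hb) (pow_ne_zero _ hp.ne_zero)
  exact gen_unique (Qcyc (p ^ b)) (Qcyc (p ^ (b + 1))) hp hcyc hrel hx hdvd

theorem Qcyc_galois_step {p M : ℕ} (hp : p.Prime) (hM : p ∣ M) (hM0 : M ≠ 0)
    (x : Qcyc (M * p))
    (h : ∀ σ : Qcyc (M * p) ≃+* Qcyc (M * p), (∀ y, σ^[p] y = y) →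
      (∀ y : Qcyc (M * p), (y : ℂ) ∈ Qcyc M → σ y = y) → σ x = x) : (x : ℂ) ∈ Qcyc M := by
  have : NeZero (M * p) := ⟨mul_ne_zero hM0 hp.ne_zero⟩
  have := Qcyc_finiteDim (M * p)
  have := Qcyc_isGalois (M * p)
  exact gen_galois_step _ _ (Qcyc_relfinrank hp hM hM0) x h

section RepPart

theorem schur_scalar {H : Type} [Group H] (V : FDRep ℂ H) (hV : Simple V) (f : V →ₗ[ℂ] V)
    (hf : ∀ g, V.ρ g ∘ₗ f = f ∘ₗ V.ρ g) : ∃ c : ℂ, f = c • LinearMap.id := by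
  let F : V ⟶ V := ⟨InducedCategory.homMk (ModuleCat.ofHom f), fun g => by
    ext1
    ext x
    exact (LinearMap.congr_fun (hf g) x).symm⟩
  obtain ⟨c, hc⟩ := CategoryTheory.endomorphism_simple_eq_smul_id ℂ F
  refine ⟨c, ?_⟩
  have h2 : F.hom.hom.hom = f := rfl
  rw [← h2, ← hc]
  rfl

theorem conv_scalar {H ι : Type} [Group H] [Fintype ι] (V : FDRep ℂ H) (hV : Simple V)
    (x : ι → H) (α : ι → ℂ)
    (hα : ∀ g : H, ∃ e : ι ≃ ι, ∀ i, x (e i) = g * x i * g⁻¹ ∧ α (e i) = α i) :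
    ∃ c : ℂ, ∀ y, ∑ i, α i * V.character (x i * y) = c * V.character y := by
  obtain ⟨c, hc⟩ := schur_scalar V hV (∑ i, α i • V.ρ (x i)) (by
    intro g
    obtain ⟨e, he⟩ := hα g
    have h1 : V.ρ g ∘ₗ (∑ i, α i • V.ρ (x i)) = ∑ i, α i • V.ρ (g * x i) := by
      ext v
      simp [LinearMap.sum_apply, map_sum]
    have h2 : (∑ i, α i • V.ρ (x i)) ∘ₗ V.ρ g = ∑ i, α i • V.ρ (x i * g) := by
      ext v
      simp [LinearMap.sum_apply]
    rw [h1, h2, ← Equiv.sum_comp e (fun i => α i • V.ρ (x i * g))]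
    refine Finset.sum_congr rfl fun i _ => ?_
    rw [(he i).1, (he i).2]
    simp)
  refine ⟨c, fun y => ?_⟩
  have h := congrArg (fun T => LinearMap.trace ℂ V (T * V.ρ y)) hc
  simp only [Finset.sum_mul, map_sum, smul_mul_assoc, map_smul, smul_eq_mul] at h
  unfold FDRep.character
  simp only [map_mul]
  exact h

theorem char_mem_Qcyc {H : Type} [Group H] (V : FDRep ℂ H) (h : H) (n : ℕ)
    (hn : h ^ n = 1) : V.character h ∈ Qcyc n := by
  unfold FDRep.character
  rw [Module.End.trace_eq_sum_roots_charpoly_of_splits (IsAlgClosed.splits _)]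
  apply multiset_sum_mem
  intro μ hμ
  have h1 := Polynomial.isRoot_of_mem_roots hμ
  rw [← Module.End.hasEigenvalue_iff_isRoot_charpoly] at h1
  obtain ⟨v, hv⟩ := h1.exists_hasEigenvector
  have h2 := hv.pow_apply n
  rw [← map_pow, hn, map_one] at h2
  apply mem_Qcyc
  have h3 : (μ ^ n - 1) • v = 0 := by rw [sub_smul, ← h2]; simp
  rcases smul_eq_zero.1 h3 with h4 | h4
  · exact sub_eq_zero.1 h4
  · exact absurd h4 hv.2

open scoped Matrix ComplexOrder in
theorem char_inv_conj {H : Type} [Group H] [Fintype H] (V : FDRep ℂ H) (h : H) :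
    (starRingEnd ℂ) (V.character h) = V.character h⁻¹ := by
  classical
  let b := Module.finBasis ℂ V
  let A : H → Matrix _ _ ℂ := fun g => LinearMap.toMatrix b b (V.ρ g)
  have hA : ∀ g k, A (g * k) = A g * A k := by
    intro g k
    simp only [A, map_mul]
    exact LinearMap.toMatrix_mul b _ _
  have hA1 : A 1 = 1 := by simp only [A, map_one]; exact LinearMap.toMatrix_one b
  have htr : ∀ g, V.character g = (A g).trace := fun g =>
    LinearMap.trace_eq_matrix_trace ℂ b (V.ρ g)
  let P := ∑ g, (A g)ᴴ * A g
  have hP : IsUnit P := by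
    have : P.PosDef := by
      have hsplit : P = (A 1)ᴴ * A 1 + ∑ g ∈ Finset.univ.erase 1, (A g)ᴴ * A g :=
        (Finset.add_sum_erase _ _ (Finset.mem_univ 1)).symm
      rw [hsplit, hA1]
      refine Matrix.PosDef.add_posSemidef ?_ (Matrix.posSemidef_sum _ fun g _ =>
        Matrix.posSemidef_conjTranspose_mul_self _)
      simpa using Matrix.PosDef.one
    exact this.isUnit
  have hinv : (A h)ᴴ * P = P * A h⁻¹ := by
    have h1 : (A h)ᴴ * P * A h = P := by
      simp only [P, Finset.mul_sum, Finset.sum_mul]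
      rw [← Equiv.sum_comp (Equiv.mulRight h) (fun g => (A g)ᴴ * A g)]
      refine Finset.sum_congr rfl fun g _ => ?_
      simp only [Equiv.coe_mulRight, hA, Matrix.conjTranspose_mul, Matrix.mul_assoc]
    calc (A h)ᴴ * P = (A h)ᴴ * P * (A h * A h⁻¹) := by rw [← hA]; simp [hA1]
      _ = P * A h⁻¹ := by rw [← Matrix.mul_assoc, h1]
  obtain ⟨u, hu⟩ := hP
  rw [htr, htr]
  have : A h⁻¹ = (↑u⁻¹ : Matrix _ _ ℂ) * (A h)ᴴ * (↑u : Matrix _ _ ℂ) := by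
    rw [Matrix.mul_assoc, hu, hinv, ← hu, ← Matrix.mul_assoc, Units.inv_mul, Matrix.one_mul]
  rw [this, Matrix.trace_mul_comm, ← Matrix.mul_assoc, Units.mul_inv, Matrix.one_mul,
    Matrix.trace_conjTranspose]
  rfl

end RepPart

section ClassFun

/-- Class functions behaving like irreducible characters of degree `d` for convolution. -/
def IrrLike {K N : Type} [Field K] [Group N] [Fintype N] (ψ : N → K) (d : K) : Prop :=
  (∀ x y, ψ (x * y) = ψ (y * x)) ∧ ψ 1 = d ∧
    ∀ α : N → K, (∀ x y, α (y * x * y⁻¹) = α x) →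
      ∀ y, (∑ x, α x * ψ x) * ψ y = d * ∑ x, α x * ψ (x * y)

variable {K N : Type} [Field K] [Group N] [Fintype N]

theorem sum_conv_comm (θ₁ θ₂ : N → K) (h2 : ∀ x y, θ₂ (x * y) = θ₂ (y * x)) (y : N) :
    ∑ x, θ₁ x⁻¹ * θ₂ (x * y) = ∑ x, θ₂ x⁻¹ * θ₁ (x * y) := by
  refine Fintype.sum_equiv ((Equiv.inv N).trans (Equiv.mulRight y⁻¹)) _ _ fun x => ?_
  simp only [Equiv.trans_apply, Equiv.inv_apply, Equiv.coe_mulRight, mul_inv_rev, inv_inv,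
    inv_mul_cancel_right]
  rw [h2 x y, mul_comm]

theorem IrrLike.class_inv {ψ : N → K} {d : K} (h : IrrLike ψ d) (x y : N) :
    ψ (y * x * y⁻¹)⁻¹ = ψ x⁻¹ := by
  rw [mul_inv_rev, mul_inv_rev, inv_inv, h.1]
  congr 1
  group

theorem IrrLike.eq_of_ne {θ₁ θ₂ : N → K} {d : K} (h1 : IrrLike θ₁ d) (h2 : IrrLike θ₂ d)
    (hS : ∑ x, θ₁ x⁻¹ * θ₂ x ≠ 0) : θ₁ = θ₂ := by
  funext y
  have e1 := h2.2.2 (fun x => θ₁ x⁻¹) (fun x y => h1.class_inv x y) y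
  have e2 := h1.2.2 (fun x => θ₂ x⁻¹) (fun x y => h2.class_inv x y) y
  have e3 := sum_conv_comm θ₁ θ₂ h2.1 y
  have e4 := sum_conv_comm θ₁ θ₂ h2.1 1
  simp only [mul_one] at e4
  rw [e3, ← e2, ← e4] at e1
  exact (mul_left_cancel₀ hS e1).symm

theorem IrrLike.comp_aut {ψ : N → K} {d : K} (h : IrrLike ψ d) (φ : N ≃* N) :
    IrrLike (fun x => ψ (φ x)) d := by
  refine ⟨fun x y => by simp only [map_mul]; exact h.1 _ _, by simp only [map_one]; exact h.2.1, ?_⟩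
  intro α hα y
  have := h.2.2 (fun x => α (φ.symm x)) (fun x y => by simp only [map_mul, map_inv]; exact hα _ _)
    (φ y)
  rw [← Equiv.sum_comp φ.toEquiv, ← Equiv.sum_comp φ.toEquiv (fun x => _ * ψ (x * φ y))] at this
  simpa using this

theorem IrrLike.comp_ringEquiv {ψ : N → K} {d : ℕ} (h : IrrLike ψ (d : K)) (σ : K ≃+* K) :
    IrrLike (fun x => σ (ψ x)) (d : K) := by
  refine ⟨fun x y => congrArg σ (h.1 x y),
    (congrArg σ h.2.1).trans (map_natCast σ d), ?_⟩
  intro α hα y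
  have := congrArg σ (h.2.2 (fun x => σ.symm (α x)) (fun x y => by rw [hα]) y)
  simpa [map_sum, map_mul] using this

theorem IrrLike.restrict {L : Type} [Field L] (i : K →+* L) {ψ : N → K} {d : ℕ}
    (h : IrrLike (fun x => i (ψ x)) (d : L)) : IrrLike ψ (d : K) := by
  refine ⟨fun x y => i.injective (h.1 x y), i.injective (by rw [map_natCast]; exact h.2.1), ?_⟩
  intro α hα y
  have := h.2.2 (fun x => i (α x)) (fun x y => by rw [hα]) y
  apply i.injective
  simpa [map_sum, map_mul] using this

end ClassFun

section Clifford

set_option linter.unusedSectionVars false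

variable {K G : Type} [Field K] [Group G] [Fintype G] {N : Subgroup G} [N.Normal] [Fintype N]

/-- the conjugate of a function on `N` -/
def cj (ψ : N → K) (g : G) : N → K := fun x => ψ (MulAut.conjNormal g⁻¹ x)

theorem cj_cj (ψ : N → K) (g h : G) (x : N) : cj ψ g (MulAut.conjNormal h⁻¹ x) = cj ψ (h * g) x := by
  simp [cj]

theorem cj_one (ψ : N → K) : cj ψ (1 : G) = ψ := by
  funext x; simp [cj]

theorem card_range_cj (ψ : N → K) (I : Subgroup G) (hI : ∀ g, g ∈ I ↔ cj ψ g = ψ) :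
    Nat.card (Set.range (cj ψ : G → N → K)) = I.index := by
  rw [Subgroup.index]
  have hk : Setoid.ker (cj ψ : G → N → K) = QuotientGroup.leftRel I := by
    ext g h
    rw [QuotientGroup.leftRel_apply, hI, Setoid.ker_def]
    constructor
    · intro e
      funext x
      rw [← cj_cj, ← e, cj_cj, inv_mul_cancel, cj_one]
    · intro e
      funext x
      have := congrFun e (MulAut.conjNormal g⁻¹ x)
      rw [cj_cj, mul_inv_cancel_left] at this
      rw [this]
      rfl
  have e := Setoid.quotientKerEquivRange (cj ψ : G → N → K)
  rw [hk] at e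
  exact (Nat.card_congr e).symm

theorem clifford_galois [CharZero K] {p : ℕ} (hp : p.Prime) (ψ χ : N → K) (d e : ℕ)
    (hψ : IrrLike ψ (d : K)) (I : Subgroup G) (hI : ∀ g, g ∈ I ↔ cj ψ g = ψ)
    (hindex : ¬ p ∣ I.index) (κ : K) (hχ : ∀ y, χ y = κ * ∑ g : G, cj ψ g y)
    (he0 : e ≠ 0) (he : ∑ x : N, ψ x⁻¹ * χ x = Fintype.card N * e)
    (σ : K ≃+* K) (hσ : ∀ y, σ^[p] y = y) (hσχ : ∀ x, σ (χ x) = χ x) (x : N) :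
    σ (ψ x) = ψ x := by
  have hθ := hψ.comp_ringEquiv σ
  obtain ⟨g₀, hg₀⟩ : ∃ g : G, (fun x => σ (ψ x)) = cj ψ g := by
    by_contra hno
    push Not at hno
    have hz : ∀ g : G, ∑ x : N, σ (ψ x⁻¹) * cj ψ g x = 0 := by
      intro g
      by_contra hne
      exact hno g (hθ.eq_of_ne (hψ.comp_aut (MulAut.conjNormal g⁻¹)) hne)
    have h1 : ∑ x : N, σ (ψ x⁻¹) * χ x = 0 := by
      have : ∑ x : N, σ (ψ x⁻¹) * χ x = κ * ∑ g : G, ∑ x : N, σ (ψ x⁻¹) * cj ψ g x := by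
        rw [Finset.sum_comm, Finset.mul_sum]
        refine Finset.sum_congr rfl fun x _ => ?_
        rw [hχ, ← Finset.mul_sum]; ring
      rw [this, Finset.sum_eq_zero (fun g _ => hz g), mul_zero]
    have h2 := congrArg σ he
    simp only [map_sum, map_mul, hσχ, map_natCast, h1] at h2
    have h3 : (Fintype.card N : K) ≠ 0 := Nat.cast_ne_zero.2 Fintype.card_ne_zero
    have h4 : (e : K) ≠ 0 := Nat.cast_ne_zero.2 he0
    exact mul_ne_zero h3 h4 h2.symm
  have hstep : ∀ g : G, (fun x => σ (cj ψ g x)) = cj ψ (g * g₀) := by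
    intro g
    funext x
    rw [← cj_cj, ← hg₀]
    rfl
  classical
  let R := Set.range (cj ψ : G → N → K)
  have : Finite R := Set.finite_range _
  have : Fintype R := Fintype.ofFinite R
  let T : R → R := fun θ => ⟨fun x => σ (θ.1 x), by
    obtain ⟨_, g, rfl⟩ := θ
    exact ⟨g * g₀, (hstep g).symm⟩⟩
  have hT : Function.Injective T := by
    intro a b hab
    apply Subtype.ext
    funext x
    exact σ.injective (congrFun (congrArg Subtype.val hab) x)
  let P : Equiv.Perm R := Equiv.ofBijective T (Finite.injective_iff_bijective.1 hT)
  have hPn : ∀ (n : ℕ) (θ : R) (x : N), ((P ^ n) θ).1 x = σ^[n] (θ.1 x) := by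
    intro n
    induction n with
    | zero => intro θ x; rfl
    | succ n ih =>
      intro θ x
      rw [pow_succ', Function.iterate_succ_apply', ← ih]
      rfl
  have hP : P ^ p ^ 1 = 1 := by
    rw [pow_one]
    ext θ x
    rw [hPn, hσ]
    rfl
  have : Fact p.Prime := ⟨hp⟩
  obtain ⟨⟨_, g, rfl⟩, hg⟩ := Equiv.Perm.exists_fixed_point_of_prime (p := p) (n := 1)
    (by rw [← Nat.card_eq_fintype_card, card_range_cj ψ I hI]; exact hindex) hP
  have h5 : ∀ y, σ (cj ψ g y) = cj ψ g y := fun y => congrFun (congrArg Subtype.val hg) y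
  have := h5 (MulAut.conjNormal g x)
  simpa [cj] using this

theorem clifford_formula [CharZero K] (ψ : N → K) (χ : G → K) (d D e : ℕ) (hd : d ≠ 0)
    (hψ : IrrLike ψ (d : K)) (hnorm : ∑ x, ψ x⁻¹ * ψ x = Fintype.card N)
    (I : Subgroup G) (hI : ∀ g, g ∈ I ↔ cj ψ g = ψ)
    (hcl : ∀ x y, χ (x * y) = χ (y * x)) (hD : χ 1 = D)
    (hconv : ∀ α : N → K, (∀ (g : G) x, α (MulAut.conjNormal g x) = α x) →
      ∀ y, (∑ x : N, α x * χ x) * χ y = D * ∑ x : N, α x * χ (x * y))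
    (he0 : e ≠ 0) (he : ∑ x : N, ψ x⁻¹ * χ x = Fintype.card N * e) :
    D = e * I.index * d ∧
      ∀ y : N, χ y = ((Nat.card I : K)⁻¹ * e) * ∑ g : G, cj ψ g y := by
  classical
  have hN0 : (Fintype.card N : K) ≠ 0 := Nat.cast_ne_zero.2 Fintype.card_ne_zero
  have hG0 : (Nat.card G : K) ≠ 0 := Nat.cast_ne_zero.2 Nat.card_pos.ne'
  have hI0 : (Nat.card I : K) ≠ 0 := Nat.cast_ne_zero.2 Nat.card_pos.ne'
  have he0' : (e : K) ≠ 0 := Nat.cast_ne_zero.2 he0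
  have hd' : (d : K) ≠ 0 := Nat.cast_ne_zero.2 hd
  have hcj : ∀ (g : G) (x : N), χ (MulAut.conjNormal g x : N) = χ x := by
    intro g x
    rw [MulAut.conjNormal_apply, hcl, ← mul_assoc, inv_mul_cancel, one_mul]
  let ξ : N → K := fun x => χ x
  have hξcl : ∀ x y, ξ (x * y) = ξ (y * x) := fun x y => hcl x y
  let φ : N → K := fun x => ∑ g : G, cj ψ g x
  have hirr : ∀ g : G, IrrLike (cj ψ g) (d : K) := fun g => hψ.comp_aut (MulAut.conjNormal g⁻¹)
  have hφcj : ∀ (g : G) x, φ (MulAut.conjNormal g x) = φ x := by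
    intro g x
    simp only [φ]
    rw [← Equiv.sum_comp (Equiv.mulLeft g) (fun h => cj ψ h (MulAut.conjNormal g x))]
    refine Finset.sum_congr rfl fun h _ => ?_
    simp [cj]
  -- all pairings of conjugates with `χ` agree
  have hT : ∀ g : G, ∑ x : N, cj ψ g x⁻¹ * ξ x = Fintype.card N * e := by
    intro g
    rw [← he, ← Equiv.sum_comp (MulAut.conjNormal g).toEquiv (fun x : N => cj ψ g x⁻¹ * ξ x)]
    refine Finset.sum_congr rfl fun x _ => ?_
    have : ξ (MulAut.conjNormal g x) = ξ x := hcj g x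
    simp [cj, this, ξ]
  have hT' : ∀ g : G, ∑ x : N, ξ x⁻¹ * cj ψ g x = Fintype.card N * e := by
    intro g
    have := sum_conv_comm (cj ψ g) ξ hξcl 1
    simp only [mul_one] at this
    rw [← this, hT]
  have h1 : ∀ y : N, (Fintype.card N * e) * φ y = d * ∑ x : N, ξ x⁻¹ * φ (x * y) := by
    intro y
    have : ∑ x : N, ξ x⁻¹ * φ (x * y) = ∑ g : G, ∑ x : N, ξ x⁻¹ * cj ψ g (x * y) := by
      rw [Finset.sum_comm]
      exact Finset.sum_congr rfl fun x _ => Finset.mul_sum _ _ _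
    rw [this, Finset.mul_sum, Finset.mul_sum]
    refine Finset.sum_congr rfl fun g _ => ?_
    rw [← (hirr g).2.2 (fun x => ξ x⁻¹) (fun x y => ?_) y, hT']
    have := hcj (y : G) x⁻¹
    have e2 : (y * x * y⁻¹)⁻¹ = MulAut.conjNormal (y : G) x⁻¹ := by
      apply Subtype.ext
      rw [MulAut.conjNormal_apply]
      simp [mul_assoc]
    rw [e2]; exact this
  have hS : ∑ x : N, φ x⁻¹ * ξ x = Nat.card G * (Fintype.card N * e) := by
    have : ∑ x : N, φ x⁻¹ * ξ x = ∑ g : G, ∑ x : N, cj ψ g x⁻¹ * ξ x := by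
      rw [Finset.sum_comm]
      exact Finset.sum_congr rfl fun x _ => Finset.sum_mul _ _ _
    rw [this, Finset.sum_congr rfl fun g _ => hT g]
    simp
  have h2 : ∀ y : N, (d * Nat.card G) * ξ y = D * φ y := by
    intro y
    have e1 := hconv (fun x => φ x⁻¹) (fun g x => by rw [← map_inv]; exact hφcj g _) y
    have e2 := sum_conv_comm φ ξ hξcl y
    have e3 : ∑ x : N, φ x⁻¹ * χ (x * y) = ∑ x : N, φ x⁻¹ * ξ (x * y) := rfl
    have e4 : ∑ x : N, φ x⁻¹ * χ x = ∑ x : N, φ x⁻¹ * ξ x := rfl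
    rw [e3, e2, e4, hS] at e1
    have e5 := h1 y
    apply mul_left_cancel₀ (mul_ne_zero hN0 he0')
    linear_combination (d : K) * e1 - (D : K) * e5
  have h3 : ∑ y : N, ψ y⁻¹ * φ y = Nat.card I * Fintype.card N := by
    have e1 : ∑ y : N, ψ y⁻¹ * φ y = ∑ g : G, ∑ y : N, ψ y⁻¹ * cj ψ g y := by
      rw [Finset.sum_comm]
      exact Finset.sum_congr rfl fun x _ => Finset.mul_sum _ _ _
    have e2 : ∀ g : G, ∑ y : N, ψ y⁻¹ * cj ψ g y = if g ∈ I then (Fintype.card N : K) else 0 := by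
      intro g
      split_ifs with hg
      · rw [(hI g).1 hg, hnorm]
      · by_contra hne
        exact hg ((hI g).2 (hψ.eq_of_ne (hirr g) hne).symm)
    rw [e1, Finset.sum_congr rfl fun g _ => e2 g, ← Finset.sum_filter, Finset.sum_const,
      nsmul_eq_mul]
    congr 2
    rw [← Fintype.card_subtype, Nat.card_eq_fintype_card]
  have h4 : (d * Nat.card G : K) * e = D * Nat.card I := by
    have e1 : ∑ y : N, ψ y⁻¹ * ((d * Nat.card G) * ξ y) = ∑ y : N, ψ y⁻¹ * (D * φ y) :=
      Finset.sum_congr rfl fun y _ => by rw [h2]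
    have e2 : ∑ y : N, ψ y⁻¹ * ((d * Nat.card G) * ξ y) = (d * Nat.card G) * (Fintype.card N * e) := by
      rw [← he, Finset.mul_sum]
      exact Finset.sum_congr rfl fun y _ => by simp only [ξ]; ring
    have e3 : ∑ y : N, ψ y⁻¹ * (D * φ y) = D * (Nat.card I * Fintype.card N) := by
      rw [← h3, Finset.mul_sum]
      exact Finset.sum_congr rfl fun y _ => by ring
    rw [e2, e3] at e1
    apply mul_left_cancel₀ hN0
    linear_combination e1
  constructor
  · have h5 : d * Nat.card G * e = D * Nat.card I := by exact_mod_cast h4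
    rw [← Subgroup.card_mul_index I] at h5
    apply Nat.eq_of_mul_eq_mul_left (Nat.card_pos (α := I))
    linarith
  · intro y
    have e1 := h2 y
    apply mul_left_cancel₀ (mul_ne_zero hI0 (mul_ne_zero hd' hG0))
    change _ * ξ y = _ * (_ * φ y)
    have : (Nat.card I : K) * (d * Nat.card G) * ((Nat.card I : K)⁻¹ * e * φ y)
        = (d * Nat.card G * e) * φ y := by field_simp
    rw [this, h4]
    linear_combination (Nat.card I : K) * e1

end Clifford

theorem irrLike_char {H : Type} [Group H] [Fintype H] (W : FDRep ℂ H) (hW : Simple W) :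
    IrrLike W.character ((Module.finrank ℂ W : ℕ) : ℂ) := by
  refine ⟨fun x y => W.char_mul_comm y x, W.char_one, ?_⟩
  intro α hα y
  obtain ⟨c, hc⟩ := conv_scalar W hW (fun x : H => x) α
    (fun g => ⟨(MulAut.conj g).toEquiv, fun i => ⟨rfl, hα i g⟩⟩)
  have h1 := hc 1
  simp only [mul_one] at h1
  rw [h1, hc y, W.char_one]
  ring

theorem char_norm {H : Type} [Group H] [Fintype H] (W : FDRep ℂ H) (hW : Simple W) :
    ∑ x, W.character x⁻¹ * W.character x = Fintype.card H := by
  have h0 : (Nat.card H : ℂ) ≠ 0 := Nat.cast_ne_zero.2 Nat.card_pos.ne'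
  have : Invertible (Nat.card H : ℂ) := invertibleOfNonzero h0
  have h := FDRep.char_orthonormal W W
  rw [if_pos ⟨Iso.refl W⟩, inv_mul_eq_one₀ h0] at h
  rw [← Nat.card_eq_fintype_card, h]
  exact Finset.sum_congr rfl fun x _ => mul_comm _ _

theorem finrank_ne_zero_of_simple {H : Type} [Group H] [Fintype H] (W : FDRep ℂ H)
    (hW : Simple W) : Module.finrank ℂ W ≠ 0 := by
  intro h0
  have hi := irrLike_char W hW
  have hn := char_norm W hW
  have h1 : ∀ x, W.character x = 0 := by
    intro x
    have : Subsingleton W := Module.finrank_zero_iff.1 h0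
    have h2 : W.ρ x = 0 := LinearMap.ext fun v => Subsingleton.elim _ _
    unfold FDRep.character
    rw [h2, map_zero]
  have h3 : (0 : ℂ) = (Fintype.card H : ℂ) := by
    rw [← hn]
    exact (Finset.sum_eq_zero fun x _ => by rw [h1 x, mul_zero]).symm
  exact (Nat.cast_ne_zero.2 Fintype.card_ne_zero : (Fintype.card H : ℂ) ≠ 0) h3.symm

theorem conv_char {G : Type} [Group G] [Fintype G] (N : Subgroup G) [N.Normal] [Fintype N]
    (V : FDRep ℂ G) (hV : Simple V) (α : N → ℂ)
    (hα : ∀ (g : G) x, α (MulAut.conjNormal g x) = α x) (y : G) :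
    (∑ x : N, α x * V.character x) * V.character y
      = ((Module.finrank ℂ V : ℕ) : ℂ) * ∑ x : N, α x * V.character (x * y) := by
  obtain ⟨c, hc⟩ := conv_scalar V hV (fun x : N => (x : G)) α
    (fun g => ⟨(MulAut.conjNormal g).toEquiv, fun i => ⟨MulAut.conjNormal_apply g i, hα g i⟩⟩)
  have h1 := hc 1
  simp only [mul_one] at h1
  rw [h1, hc y, V.char_one]
  ring

theorem orderOf_conjNormal_mk {G : Type} [Group G] (N : Subgroup G) [N.Normal] (u g : G)
    (hg : g ∈ N) : orderOf (MulAut.conjNormal u (⟨g, hg⟩ : N)) = orderOf g := by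
  have h : orderOf (MulAut.conjNormal u (⟨g, hg⟩ : N)) = orderOf (⟨g, hg⟩ : N) :=
    orderOf_injective (MulAut.conjNormal u : N ≃* N).toMonoidHom
      (MulAut.conjNormal u : N ≃* N).injective _
  rw [h, Subgroup.orderOf_mk]

set_option maxHeartbeats 2000000 in
/-- Clifford-theoretic descent of Property 1.3 from a group `G` to a normal
subgroup `N`.  Here `χ` is an irreducible character of `G`, `ψ` an irreducible character of
`N` occurring with multiplicity `e = ⟨χ↓_N, ψ⟩ ≠ 0` in the restriction `χ↓_N`,
`p ∤ [G : I_G(ψ)]`, `p ∤ e`, `p ∤ χ(1)`, and Property 1.3 holds for `(G, χ, p)` with a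
witnessing `p`-element lying in `N`.  Then `p ∤ ψ(1)` and Property 1.3 holds for
`(N, ψ, p)`. -/
theorem stmt14 (G : Type) [Group G] [Fintype G]
    (N : Subgroup G) (hN : N.Normal) [Fintype N]
    (p : ℕ) (hp : p.Prime) (hodd : Odd p)
    (V : FDRep ℂ G) (hV : Simple V)
    (W : FDRep ℂ N) (hW : Simple W)
    (e : ℕ)
    (he : (e : ℂ) = (Fintype.card N : ℂ)⁻¹ *
      ∑ x : N, V.character ↑x * (starRingEnd ℂ) (W.character x))
    (he0 : e ≠ 0) (hpe : ¬ p ∣ e)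
    (hindex : ¬ p ∣ (inertiaGroup hN W.character).index)
    (hdeg : ¬ p ∣ Module.finrank ℂ V)
    (hprop : ∀ f : ℕ, IsCharConductor V.character f →
      ∃ g : G, g ∈ N ∧ (∃ j : ℕ, orderOf g = p ^ j) ∧
        ¬ p ∣ (Qadj (V.character g)).relfinrank (Qcyc (p ^ f.factorization p))) :
    ¬ p ∣ Module.finrank ℂ W ∧ Property13 W.character p := by
  have := hN
  set ψ : N → ℂ := W.character with hψdef
  set d := Module.finrank ℂ W with hd
  set D := Module.finrank ℂ V with hDdef
  set I := inertiaGroup hN ψ with hIdef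
  have hψ : IrrLike ψ (d : ℂ) := irrLike_char W hW
  have hI : ∀ g, g ∈ I ↔ cj ψ g = ψ := by
    have key : ∀ (g x : G) (hx : x ∈ N), cj ψ g ⟨x, hx⟩
        = ψ ⟨g⁻¹ * x * g, hN.conj_mem' x hx g⟩ := by
      intro g x hx
      refine congrArg ψ (Subtype.ext ?_)
      rw [MulAut.conjNormal_apply, inv_inv]
    intro g
    constructor
    · intro hg
      funext x
      obtain ⟨x, hx⟩ := x
      rw [key]
      exact hg x hx
    · intro hg x hx
      rw [← key, hg]
  have hN0 : (Fintype.card N : ℂ) ≠ 0 := Nat.cast_ne_zero.2 Fintype.card_ne_zero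
  have he' : ∑ x : N, ψ x⁻¹ * V.character x = Fintype.card N * e := by
    rw [he, mul_inv_cancel_left₀ hN0]
    refine Finset.sum_congr rfl fun x _ => ?_
    rw [char_inv_conj, mul_comm]
  obtain ⟨hDeq, hform⟩ := clifford_formula ψ V.character d D e (finrank_ne_zero_of_simple W hW)
    hψ (char_norm W hW) I hI (fun x y => V.char_mul_comm y x) V.char_one
    (conv_char N V hV) he0 he'
  refine ⟨fun h => hdeg (hDeq ▸ Dvd.dvd.mul_left h _), ?_⟩
  intro f hf
  have hf0 : f ≠ 0 := hf.1.1.ne'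
  obtain ⟨k, hk⟩ : ∃ k, IsCharConductor V.character k := by
    have hne : {n : ℕ | 0 < n ∧ ∀ g, V.character g ∈ Qcyc n}.Nonempty :=
      ⟨Nat.card G, Nat.card_pos, fun g => char_mem_Qcyc V g _ pow_card_eq_one'⟩
    exact ⟨sInf _, Nat.sInf_mem hne, fun n hn => Nat.sInf_le hn⟩
  have hk0 : k ≠ 0 := hk.1.1.ne'
  obtain ⟨g, hgN, ⟨j, hj⟩, hg⟩ := hprop k hk
  set a := k.factorization p with ha
  set b := f.factorization p with hb
  have hkm : p ^ a * (k / p ^ a) = k := Nat.ordProj_mul_ordCompl_eq_self k p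
  have hfm : p ^ b * (f / p ^ b) = f := Nat.ordProj_mul_ordCompl_eq_self f p
  have hpm : ¬ p ∣ k / p ^ a := Nat.not_dvd_ordCompl hp hk0
  have hpm' : ¬ p ∣ f / p ^ b := Nat.not_dvd_ordCompl hp hf0
  generalize k / p ^ a = m at hkm hpm
  generalize f / p ^ b = m' at hfm hpm'
  have hm0 : m ≠ 0 := by rintro rfl; exact hpm (dvd_zero p)
  have hm0' : m' ≠ 0 := by rintro rfl; exact hpm' (dvd_zero p)
  clear_value a b
  rcases Nat.lt_or_ge b 2 with hb2 | hb2
  · refine ⟨1, ⟨0, by simp⟩, fun hdvd => ?_⟩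
    have : NeZero (p ^ b) := ⟨pow_ne_zero _ hp.ne_zero⟩
    have h1 := hdvd.trans (IntermediateField.relfinrank_dvd_finrank_bot _ _)
    rw [Qcyc_finrank] at h1
    have h2 : b = 0 ∨ b = 1 := by omega
    rcases h2 with rfl | rfl
    · simp only [pow_zero, Nat.totient_one] at h1
      exact hp.one_lt.ne' (Nat.dvd_one.1 h1)
    · rw [pow_one, Nat.totient_prime hp] at h1
      have := Nat.le_of_dvd (Nat.sub_pos_of_lt hp.one_lt) h1
      have := hp.pos
      omega
  obtain ⟨c, rfl⟩ : ∃ c, b = c + 1 := ⟨b - 1, by omega⟩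
  have hc0 : c ≠ 0 := by omega
  by_contra hcon
  push Not at hcon
  -- the `p`-part of the conductor of `ψ` divides that of `χ`
  have hba : c + 1 ≤ a := by
    by_contra hlt
    set M := p ^ c * (m * m') with hM
    have hpM : p ∣ M := Dvd.dvd.mul_right (dvd_pow_self p hc0) _
    have hM0 : M ≠ 0 := mul_ne_zero (pow_ne_zero _ hp.ne_zero) (mul_ne_zero hm0 hm0')
    have hMp : Qcyc M ≤ Qcyc (M * p) := Qcyc_mono (Dvd.intro p rfl)
    have hχM : ∀ x, V.character x ∈ Qcyc M := fun x => by
      refine Qcyc_mono ?_ (hk.1.2 x)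
      rw [← hkm, hM]
      exact mul_dvd_mul (pow_dvd_pow p (by omega)) (Dvd.intro _ rfl)
    have hψM : ∀ x, ψ x ∈ Qcyc (M * p) := fun x => by
      refine Qcyc_mono ?_ (hf.1.2 x)
      rw [← hfm, hM]
      exact ⟨m, by ring⟩
    let ψE : N → Qcyc (M * p) := fun x => ⟨ψ x, hψM x⟩
    let χE : N → Qcyc (M * p) := fun x => ⟨V.character x, hMp (hχM x)⟩
    have hirrE : IrrLike ψE (d : Qcyc (M * p)) :=
      IrrLike.restrict (Qcyc (M * p)).val.toRingHom hψ
    have hIE : ∀ g, g ∈ I ↔ cj ψE g = ψE := by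
      intro g
      rw [hI, funext_iff, funext_iff]
      exact forall_congr' fun x => (Subtype.ext_iff (a1 := cj ψE g x) (a2 := ψE x)).symm
    have hstep : ∀ x, ψ x ∈ Qcyc M := by
      intro x
      refine Qcyc_galois_step hp hpM hM0 (ψE x) ?_
      intro σ hσ hσM
      refine clifford_galois hp ψE χE d e hirrE I hIE hindex ((Nat.card I : Qcyc (M * p))⁻¹ * e)
        ?_ he0 ?_ σ hσ (fun x => hσM _ (hχM x)) x
      · intro y
        apply Subtype.ext
        have := hform y
        simp only [χE]
        rw [this]
        push_cast
        rfl
      · apply Subtype.ext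
        push_cast
        exact he'
    have hle : ∀ x, ψ x ∈ Qcyc (p ^ c * m') := fun x =>
      Qcyc_descent hp hc0 (mul_ne_zero hm0 hm0')
        (fun h => (hp.dvd_mul.1 h).elim hpm hpm') (Dvd.intro_left _ rfl)
        (by rw [hfm]; exact hf.1.2 x) (hstep x)
    have h1 : f ≤ p ^ c * m' := hf.2 ⟨Nat.pos_of_ne_zero
      (mul_ne_zero (pow_ne_zero _ hp.ne_zero) hm0'), hle⟩
    rw [← hfm, pow_succ] at h1
    have h2 : 0 < p ^ c * m' := Nat.pos_of_ne_zero
      (mul_ne_zero (pow_ne_zero _ hp.ne_zero) hm0')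
    have h3 := hp.two_le
    nlinarith
  -- values of `ψ` on `p`-elements
  have hval : ∀ h : N, (∃ j : ℕ, orderOf h = p ^ j) → ψ h ∈ Qcyc (p ^ c) := by
    intro h hh
    have hd1 := hcon h hh
    obtain ⟨i, hi⟩ := hh
    have h1 : ψ h ∈ Qcyc (p ^ i) := char_mem_Qcyc W h _ (by rw [← hi]; exact pow_orderOf_eq_one h)
    have h2 : ψ h ∈ Qcyc (p ^ (c + 1)) :=
      Qcyc_descent_iter hp (Nat.succ_ne_zero c) hm0' hpm' (by rw [hfm]; exact hf.1.2 h) i h1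
    exact Qcyc_unique hp hodd hc0 h2 hd1
  have hχg : V.character g ∈ Qcyc (p ^ c) := by
    have h1 := hform ⟨g, hgN⟩
    simp only at h1
    rw [h1]
    refine mul_mem (mul_mem (inv_mem (natCast_mem _ _)) (natCast_mem _ _)) (sum_mem fun u _ => ?_)
    exact hval (MulAut.conjNormal u⁻¹ ⟨g, hgN⟩)
      ⟨j, (orderOf_conjNormal_mk N u⁻¹ g hgN).trans hj⟩
  obtain ⟨a', rfl⟩ : ∃ a', a = a' + 1 := ⟨a - 1, by omega⟩
  apply hg
  have hle1 : Qadj (V.character g) ≤ Qcyc (p ^ a') := by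
    unfold Qadj
    rw [IntermediateField.adjoin_simple_le_iff]
    exact Qcyc_mono (pow_dvd_pow p (by omega)) hχg
  have h3 := IntermediateField.relfinrank_dvd_of_le_left (Qcyc (p ^ (a' + 1))) hle1
  have h4 : (Qcyc (p ^ a')).relfinrank (Qcyc (p ^ (a' + 1))) = p := by
    rw [pow_succ]
    exact Qcyc_relfinrank hp (dvd_pow_self p (by omega)) (pow_ne_zero _ hp.ne_zero)
  rwa [h4] at h3
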